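/- The operator D on P commutes with every T_i: D T_i = T_i D for all 1 ≤ i ≤ N−1. -/

import Mathlib

open Finset

noncomputable def phi (K : Type*) [Field K] (E : Finset ℕ) : Finset ℕ →₀ K :=
  Finsupp.single E 1

noncomputable def Tgen {K : Type*} [Field K] (t : K) (i : ℕ) :
    (Finset ℕ →₀ K) →ₗ[K] (Finset ℕ →₀ K) :=
  Finsupp.lift _ K _ fun E =>
    if i ∈ E then
      if i + 1 ∈ E then -(phi K E)
      else phi K (insert (i + 1) (E.erase i))
    else
      if i + 1 ∈ E then t • phi K (insert i (E.erase (i + 1))) + (t - 1) • phi K E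
      else t • phi K E

def sgn (i : ℕ) (E : Finset ℕ) : ℕ := (E.filter (· < i)).card

noncomputable def Mop (K : Type*) [Field K] (N : ℕ) :
    (Finset ℕ →₀ K) →ₗ[K] (Finset ℕ →₀ K) :=
  Finsupp.lift _ K _ fun E =>
    ∑ i ∈ (Finset.Icc 1 N) \ E, ((-1 : K) ^ sgn i E) • phi K (insert i E)

noncomputable def Dop {K : Type*} [Field K] (t : K) :
    (Finset ℕ →₀ K) →ₗ[K] (Finset ℕ →₀ K) :=
  Finsupp.lift _ K _ fun E =>
    ∑ i ∈ E, ((-1 : K) ^ sgn i E * t ^ (i - 1)) • phi K (E.erase i)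

noncomputable def qint {K : Type*} [Field K] (t : K) (n : ℕ) : K :=
  ∑ i ∈ Finset.range n, t ^ i

noncomputable def kappa {K : Type*} [Field K] (t : K) (n : ℤ) : K :=
  if 0 < n then t ^ n.toNat / qint t n.toNat else -(1 / qint t (-n).toNat)

section Operators

variable {K : Type*} [Field K] (t : K) {i : ℕ} {F : Finset ℕ}

theorem Dop_phi (E : Finset ℕ) :
    Dop t (phi K E) = ∑ j ∈ E, ((-1 : K) ^ sgn j E * t ^ (j - 1)) • phi K (E.erase j) := by
  simp [Dop, phi]

theorem Tgen_phi (i : ℕ) (E : Finset ℕ) :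
    Tgen t i (phi K E) =
      if i ∈ E then
        if i + 1 ∈ E then -(phi K E)
        else phi K (insert (i + 1) (E.erase i))
      else
        if i + 1 ∈ E then t • phi K (insert i (E.erase (i + 1))) + (t - 1) • phi K E
        else t • phi K E := by
  rw [Tgen, Finsupp.lift_apply]
  nth_rw 1 [phi]
  rw [Finsupp.sum_single_index (by exact zero_smul K _), one_smul]

theorem Tgen_phi_of_notMem (h : i ∉ F) (h' : i + 1 ∉ F) :
    Tgen t i (phi K F) = t • phi K F := by
  simp [Tgen_phi, h, h']

theorem Tgen_phi_insert_left (h : i ∉ F) (h' : i + 1 ∉ F) :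
    Tgen t i (phi K (insert i F)) = phi K (insert (i + 1) F) := by
  simp [Tgen_phi, h, h']

theorem Tgen_phi_insert_right (h : i ∉ F) (h' : i + 1 ∉ F) :
    Tgen t i (phi K (insert (i + 1) F)) =
      t • phi K (insert i F) + (t - 1) • phi K (insert (i + 1) F) := by
  simp [Tgen_phi, h, h']

theorem Tgen_phi_insert_insert :
    Tgen t i (phi K (insert i (insert (i + 1) F))) = -phi K (insert i (insert (i + 1) F)) := by
  simp [Tgen_phi]

theorem sgn_insert {a : ℕ} (h : a ∉ F) (j : ℕ) :
    sgn j (insert a F) = sgn j F + if a < j then 1 else 0 := by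
  unfold sgn
  rw [filter_insert]
  split_ifs <;> simp [h]

theorem sgn_succ (h : i ∉ F) : sgn (i + 1) F = sgn i F := by
  unfold sgn
  congr 1
  refine filter_congr fun j hj => ?_
  have : j ≠ i := ne_of_mem_of_not_mem hj h
  omega

/-- Splitting off the term of `D φ_E` that removes a chosen element `a` of `E = F ∪ {a}`. -/
theorem Dop_phi_insert {a : ℕ} (h : a ∉ F) :
    Dop t (phi K (insert a F)) = ((-1 : K) ^ sgn a F * t ^ (a - 1)) • phi K F +
      ∑ j ∈ F, ((if a < j then -1 else 1) * ((-1 : K) ^ sgn j F * t ^ (j - 1))) •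
        phi K (insert a (F.erase j)) := by
  rw [Dop_phi, sum_insert h, erase_insert h, sgn_insert h]
  congr 1
  · simp
  · refine sum_congr rfl fun j hj => ?_
    rw [erase_insert_of_ne (ne_of_mem_of_not_mem hj h).symm, sgn_insert h]
    split_ifs <;> simp [pow_succ]

theorem Dop_phi_insert_succ (hi : 1 ≤ i) (h : i ∉ F) (h' : i + 1 ∉ F) :
    Dop t (phi K (insert (i + 1) F)) = ((-1 : K) ^ sgn i F * (t ^ (i - 1) * t)) • phi K F +
      ∑ j ∈ F, ((if i < j then -1 else 1) * ((-1 : K) ^ sgn j F * t ^ (j - 1))) •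
        phi K (insert (i + 1) (F.erase j)) := by
  rw [Dop_phi_insert t h', sgn_succ h, ← pow_succ, Nat.sub_add_cancel hi, Nat.add_sub_cancel]
  congr 1
  refine sum_congr rfl fun j hj => ?_
  have : j ≠ i + 1 := ne_of_mem_of_not_mem hj h'
  have hlt : i + 1 < j ↔ i < j := by omega
  simp only [hlt]

theorem Dop_phi_insert_insert (hi : 1 ≤ i) (h : i ∉ F) (h' : i + 1 ∉ F) :
    Dop t (phi K (insert i (insert (i + 1) F))) =
      ((-1 : K) ^ sgn i F * t ^ (i - 1)) • phi K (insert (i + 1) F) -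
      ((-1 : K) ^ sgn i F * (t ^ (i - 1) * t)) • phi K (insert i F) +
      ∑ j ∈ F, ((-1 : K) ^ sgn j F * t ^ (j - 1)) •
        phi K (insert i (insert (i + 1) (F.erase j))) := by
  have hi' : i ∉ insert (i + 1) F := by simp [h]
  rw [Dop_phi_insert t hi', sum_insert h', erase_insert h', sgn_insert h', sgn_insert h',
    sgn_succ h, ← pow_succ, Nat.sub_add_cancel hi, Nat.add_sub_cancel, sub_eq_add_neg, add_assoc]
  congr 1
  · simp
  congr 1
  · simp
  refine sum_congr rfl fun j hj => ?_
  have hj' : j ≠ i + 1 := ne_of_mem_of_not_mem hj h'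
  have hlt : i + 1 < j ↔ i < j := by omega
  rw [erase_insert_of_ne hj'.symm, sgn_insert h']
  simp only [hlt]
  split_ifs <;> simp [pow_succ]

/-- `D` and `T_i` commute on each `φ_E`; here `F = E \ {i, i + 1}`. -/
theorem Dop_Tgen_phi (hi : 1 ≤ i) (E : Finset ℕ) :
    Dop t (Tgen t i (phi K E)) = Tgen t i (Dop t (phi K E)) := by
  obtain ⟨F, h, h', hE⟩ : ∃ F : Finset ℕ, i ∉ F ∧ i + 1 ∉ F ∧
      (E = F ∨ E = insert i F ∨ E = insert (i + 1) F ∨ E = insert i (insert (i + 1) F)) := by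
    refine ⟨(E.erase i).erase (i + 1), by simp, by simp, ?_⟩
    by_cases h : i ∈ E <;> by_cases h' : i + 1 ∈ E
    · right; right; right
      rw [insert_erase (by simp [h']), insert_erase h]
    · right; left
      rw [erase_eq_of_notMem (by simp [h']), insert_erase h]
    · right; right; left
      rw [insert_erase (by simp [h']), erase_eq_of_notMem h]
    · left
      rw [erase_eq_of_notMem (by simp [h']), erase_eq_of_notMem h]
  have m (j : ℕ) : i ∉ F.erase j := fun hm => h (mem_of_mem_erase hm)
  have m' (j : ℕ) : i + 1 ∉ F.erase j := fun hm => h' (mem_of_mem_erase hm)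
  rcases hE with rfl | rfl | rfl | rfl
  · simp only [Tgen_phi_of_notMem t h h', Dop_phi, map_sum, map_smul,
      Tgen_phi_of_notMem t (m _) (m' _), smul_sum, smul_comm t]
  · simp only [Tgen_phi_insert_left t h h', Dop_phi_insert_succ t hi h h', Dop_phi_insert t h,
      map_add, map_sum, map_smul, Tgen_phi_of_notMem t h h',
      Tgen_phi_insert_left t (m _) (m' _), smul_smul, mul_assoc]
  · simp only [Tgen_phi_insert_right t h h', Dop_phi_insert_succ t hi h h', Dop_phi_insert t h,
      map_add, map_sum, map_smul, Tgen_phi_of_notMem t h h',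
      Tgen_phi_insert_right t (m _) (m' _), smul_add, sum_add_distrib, smul_sum,
      smul_comm _ t, smul_comm _ (t - 1)]
    module
  · simp only [Tgen_phi_insert_insert, Dop_phi_insert_insert t hi h h', map_neg,
      map_add, map_sub, map_sum, map_smul, Tgen_phi_insert_left t h h',
      Tgen_phi_insert_right t h h', smul_neg, sum_neg_distrib]
    module

end Operators

/-- The degree-lowering operator `D` commutes with every Hecke generator `T_i`,
1 ≤ i ≤ N−1. -/
theorem D_commutes_with_T {K : Type*} [Field K] (t : K) (N : ℕ) (hN : 1 ≤ N)
    (i : ℕ) (hi1 : 1 ≤ i) (hiN : i ≤ N - 1) :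
    (Dop t) ∘ₗ (Tgen t i) = (Tgen t i) ∘ₗ (Dop (K := K) t) := by
  ext1 E
  ext1
  exact Dop_Tgen_phi t hi1 E
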